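/- For every n ≥ 1, the permutation matrices are both join-dense and meet-dense in the lattice ASM_n: every alternating sign matrix A ∈ ASM_n is the least upper bound of the set of permutation matrices P with P ≤ A, and also the greatest lower bound of the set of permutation matrices P with A ≤ P. (This expresses that ASM_n is the Dedekind–MacNeille completion of the poset of permutation matrices.) -/

import Mathlib

namespace ASMPaper

/-- The nonzero entries of a vector (a row or a column of a matrix) alternate in sign:
any two nonzero entries with only zero entries strictly between them have opposite values. -/
def Alternating {n : ℕ} (v : Fin n → ℤ) : Prop :=
  ∀ j₁ j₂ : Fin n, j₁ < j₂ → v j₁ ≠ 0 → v j₂ ≠ 0 →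
    (∀ j, j₁ < j → j < j₂ → v j = 0) → v j₂ = - v j₁

/-- `A` is an alternating sign matrix: entries in `{-1,0,1}`, all row and column sums
equal to `1`, and the nonzero entries in each row and column alternate in sign. -/
def IsASM {n : ℕ} (A : Matrix (Fin n) (Fin n) ℤ) : Prop :=
  (∀ i j, A i j = -1 ∨ A i j = 0 ∨ A i j = 1) ∧
  (∀ i, ∑ j, A i j = 1) ∧
  (∀ j, ∑ i, A i j = 1) ∧
  (∀ i, Alternating (fun j => A i j)) ∧
  (∀ j, Alternating (fun i => A i j))

/-- The partial sum `C(A)_{kl} = ∑_{i ≤ k, j ≤ l} A_{ij}`. -/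
def Csum {n : ℕ} (A : Matrix (Fin n) (Fin n) ℤ) (k l : Fin n) : ℤ :=
  ∑ i ∈ Finset.Iic k, ∑ j ∈ Finset.Iic l, A i j

/-- The partial-sum (Bruhat) order on alternating sign matrices:
`A ≤ B` iff all partial sums of `A` are at least those of `B`. -/
def asmLe {n : ℕ} (A B : Matrix (Fin n) (Fin n) ℤ) : Prop :=
  ∀ k l, Csum B k l ≤ Csum A k l

end ASMPaper

namespace ASMPaper

/-- A permutation matrix: a 0-1 matrix with exactly one `1` in each row and each column. -/
def IsPermMatrix {n : ℕ} (A : Matrix (Fin n) (Fin n) ℤ) : Prop :=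
  (∀ i j, A i j = 0 ∨ A i j = 1) ∧
  (∀ i, ∃! j, A i j = 1) ∧
  (∀ j, ∃! i, A i j = 1)

end ASMPaper

namespace ASMPaper

open Finset

/-- The entry of `A` at `(i, j)`, extended by zero to all natural indices. -/
def entry {n : ℕ} (A : Matrix (Fin n) (Fin n) ℤ) (i j : ℕ) : ℤ :=
  if h : i < n ∧ j < n then A ⟨i, h.1⟩ ⟨j, h.2⟩ else 0

/-- The sum of the entries of `A` in the first `a` rows and the first `b` columns. -/
def cornerSum {n : ℕ} (A : Matrix (Fin n) (Fin n) ℤ) (a b : ℕ) : ℤ :=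
  ∑ i ∈ range a, ∑ j ∈ range b, entry A i j

section Corner

variable {n : ℕ} (A : Matrix (Fin n) (Fin n) ℤ)

lemma entry_fin (i j : Fin n) : entry A i j = A i j := by
  simp [entry]

lemma entry_transpose (i j : ℕ) : entry A.transpose i j = entry A j i := by
  simp [entry, and_comm]

lemma cornerSum_transpose (a b : ℕ) : cornerSum A.transpose a b = cornerSum A b a := by
  simp only [cornerSum, entry_transpose]
  exact sum_comm

lemma cornerSum_succ (a b : ℕ) :
    cornerSum A (a + 1) b = cornerSum A a b + ∑ j ∈ range b, entry A a j := by
  simp [cornerSum, sum_range_succ]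

lemma sum_Iic_fin (f : ℕ → ℤ) (k : Fin n) :
    ∑ i ∈ Iic k, f i = ∑ i ∈ range (k + 1), f i := by
  rw [Nat.range_succ_eq_Iic, ← Fin.map_valEmbedding_Iic, sum_map]
  rfl

lemma Csum_eq_cornerSum (k l : Fin n) : Csum A k l = cornerSum A (k + 1) (l + 1) := by
  simp only [Csum, cornerSum, ← sum_Iic_fin, entry_fin]

lemma asmLe_iff_cornerSum (B : Matrix (Fin n) (Fin n) ℤ) :
    asmLe A B ↔ ∀ a b, 1 ≤ a → 1 ≤ b → a ≤ n → b ≤ n → cornerSum B a b ≤ cornerSum A a b := by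
  simp only [asmLe, Csum_eq_cornerSum]
  constructor
  · intro h a b ha hb han hbn
    have := h ⟨a - 1, by omega⟩ ⟨b - 1, by omega⟩
    simpa [Nat.sub_add_cancel ha, Nat.sub_add_cancel hb] using this
  · intro h k l
    exact h _ _ (by omega) (by omega) (by omega) (by omega)

end Corner

/-- Interval sums of an alternating sequence with entries in `{-1, 0, 1}` lie in `{-1, 0, 1}`. -/
lemma alternating_sum_Ico {v : ℕ → ℤ} (hv : ∀ j, v j = -1 ∨ v j = 0 ∨ v j = 1)
    (halt : ∀ j₁ j₂, j₁ < j₂ → v j₁ ≠ 0 → v j₂ ≠ 0 →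
      (∀ j, j₁ < j → j < j₂ → v j = 0) → v j₂ = -v j₁)
    {p q : ℕ} (hpq : p ≤ q) :
    ∑ j ∈ Ico p q, v j = 0 ∨
      (∑ j ∈ Ico p q, v j = 1 ∨ ∑ j ∈ Ico p q, v j = -1) ∧
        ∃ m < q, v m = ∑ j ∈ Ico p q, v j ∧ ∀ j, m < j → j < q → v j = 0 := by
  induction q, hpq using Nat.le_induction with
  | base => simp
  | succ q hpq ih =>
    rw [sum_Ico_succ_top hpq]
    set T := ∑ j ∈ Ico p q, v j
    rcases ih with h0 | ⟨hT, m, hmq, hm, hz⟩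
    · rw [h0, zero_add]
      rcases hv q with h | h | h
      · exact Or.inr ⟨Or.inr h, q, by omega, rfl, fun j _ _ => by omega⟩
      · exact Or.inl h
      · exact Or.inr ⟨Or.inl h, q, by omega, rfl, fun j _ _ => by omega⟩
    · by_cases hq : v q = 0
      · rw [hq, add_zero]
        refine Or.inr ⟨hT, m, by omega, hm, fun j hj hjq => ?_⟩
        rcases Nat.lt_succ_iff_lt_or_eq.mp hjq with h | rfl
        · exact hz j hj h
        · exact hq
      · have := halt m q hmq (by omega) hq hz
        left
        omega

section ASM

variable {n : ℕ} {A : Matrix (Fin n) (Fin n) ℤ}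

lemma IsASM.transpose (hA : IsASM A) : IsASM A.transpose :=
  ⟨fun i j => hA.1 j i, hA.2.2.1, hA.2.1, hA.2.2.2.2, hA.2.2.2.1⟩

lemma sum_range_entry (i : Fin n) : ∑ j ∈ range n, entry A i j = ∑ j, A i j := by
  rw [← Fin.sum_univ_eq_sum_range]
  simp only [entry_fin]

lemma IsASM.sum_row_mem (hA : IsASM A) (i b : ℕ) :
    0 ≤ ∑ j ∈ range b, entry A i j ∧ ∑ j ∈ range b, entry A i j ≤ 1 := by
  by_cases hi : i < n
  swap
  · simp [entry, hi]
  have hv : ∀ j, entry A i j = -1 ∨ entry A i j = 0 ∨ entry A i j = 1 := by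
    intro j
    by_cases hj : j < n
    · simpa [entry, hi, hj] using hA.1 ⟨i, hi⟩ ⟨j, hj⟩
    · simp [entry, hj]
  have halt : ∀ j₁ j₂, j₁ < j₂ → entry A i j₁ ≠ 0 → entry A i j₂ ≠ 0 →
      (∀ j, j₁ < j → j < j₂ → entry A i j = 0) → entry A i j₂ = -entry A i j₁ := by
    intro j₁ j₂ hlt h₁ h₂ hz
    have hj₁ : j₁ < n := by by_contra h; simp [entry, h] at h₁
    have hj₂ : j₂ < n := by by_contra h; simp [entry, h] at h₂
    have e : ∀ j : Fin n, entry A i j = A ⟨i, hi⟩ j := fun j => entry_fin A ⟨i, hi⟩ j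
    have := hA.2.2.2.1 ⟨i, hi⟩ ⟨j₁, hj₁⟩ ⟨j₂, hj₂⟩ hlt
    simp only [← e] at this
    exact this h₁ h₂ fun j h h' => hz j h h'
  have hsum : ∑ j ∈ range n, entry A i j = 1 :=
    (sum_range_entry ⟨i, hi⟩).trans (hA.2.1 ⟨i, hi⟩)
  have hinit := alternating_sum_Ico hv halt (Nat.zero_le b)
  rw [← range_eq_Ico] at hinit
  refine ⟨?_, by omega⟩
  rcases le_total b n with hbn | hbn
  · have htail := alternating_sum_Ico hv halt hbn
    have := sum_range_add_sum_Ico (entry A i) hbn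
    omega
  · have : ∑ j ∈ range b, entry A i j = ∑ j ∈ range n, entry A i j :=
      (sum_subset (range_subset_range.mpr hbn) fun j _ hj => by
        simp only [mem_range] at hj
        simp [entry, hj]).symm
    omega

lemma IsASM.cornerSum_rows (hA : IsASM A) {a a' : ℕ} (h : a ≤ a') (b : ℕ) :
    cornerSum A a b ≤ cornerSum A a' b ∧ cornerSum A a' b ≤ cornerSum A a b + (a' - a : ℕ) := by
  induction a', h using Nat.le_induction with
  | base => simp
  | succ a' h ih =>
    have := hA.sum_row_mem a' b
    rw [cornerSum_succ]
    omega

lemma IsASM.cornerSum_cols (hA : IsASM A) (a : ℕ) {b b' : ℕ} (h : b ≤ b') :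
    cornerSum A a b ≤ cornerSum A a b' ∧ cornerSum A a b' ≤ cornerSum A a b + (b' - b : ℕ) := by
  simpa only [cornerSum_transpose] using hA.transpose.cornerSum_rows h a

lemma IsASM.cornerSum_right (hA : IsASM A) {a : ℕ} (ha : a ≤ n) : cornerSum A a n = a := by
  induction a with
  | zero => simp [cornerSum]
  | succ a ih =>
    have hrow := (sum_range_entry ⟨a, ha⟩).trans (hA.2.1 ⟨a, ha⟩)
    rw [cornerSum_succ, ih (by omega)]
    simp only at hrow
    simp [hrow]

lemma IsASM.cornerSum_bottom (hA : IsASM A) {b : ℕ} (hb : b ≤ n) : cornerSum A n b = b := by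
  rw [← cornerSum_transpose]
  exact hA.transpose.cornerSum_right hb

lemma IsASM.cornerSum_bounds (hA : IsASM A) {a b : ℕ} (ha : a ≤ n) (hb : b ≤ n) :
    0 ≤ cornerSum A a b ∧ cornerSum A a b ≤ a ∧ cornerSum A a b ≤ b ∧
      (a + b : ℤ) ≤ cornerSum A a b + n := by
  have h₁ := hA.cornerSum_rows (Nat.zero_le a) b
  have h₂ := hA.cornerSum_cols a (Nat.zero_le b)
  have h₃ := hA.cornerSum_cols a hb
  have h₄ := hA.cornerSum_right ha
  have e₁ : cornerSum A 0 b = 0 := by simp [cornerSum]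
  have e₂ : cornerSum A a 0 = 0 := by simp [cornerSum]
  omega

lemma IsASM.cornerSum_le_add (hA : IsASM A) (a b k l : ℕ) :
    cornerSum A a b ≤ cornerSum A k l + (a - k : ℕ) + (b - l : ℕ) := by
  have hrow : cornerSum A a b ≤ cornerSum A k b + (a - k : ℕ) := by
    rcases le_total a k with h | h
    · have := hA.cornerSum_rows h b
      omega
    · exact (hA.cornerSum_rows h b).2
  have hcol : cornerSum A k b ≤ cornerSum A k l + (b - l : ℕ) := by
    rcases le_total b l with h | h
    · have := hA.cornerSum_cols k h
      omega
    · exact (hA.cornerSum_cols k h).2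
  omega

end ASM

section Perm

variable {n : ℕ}

/-- The permutation matrix with ones at the positions `(i, σ i)`. -/
def permMat (σ : Equiv.Perm (Fin n)) : Matrix (Fin n) (Fin n) ℤ :=
  fun i j => if σ i = j then 1 else 0

lemma isPermMatrix_permMat (σ : Equiv.Perm (Fin n)) : IsPermMatrix (permMat σ) := by
  refine ⟨fun i j => ?_, fun i => ⟨σ i, by simp [permMat], fun j hj => ?_⟩,
    fun j => ⟨σ.symm j, by simp [permMat], fun i hi => ?_⟩⟩
  · unfold permMat
    split_ifs <;> simp
  · by_contra h
    simp [permMat, Ne.symm h] at hj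
  · by_contra h
    have : σ i ≠ j := fun e => h (by simp [← e])
    simp [permMat, this] at hi

lemma cornerSum_permMat_succ (σ : Equiv.Perm (Fin n)) (a : Fin n) {b : ℕ} (hb : b ≤ n) :
    cornerSum (permMat σ) (a + 1) b =
      cornerSum (permMat σ) a b + if (σ a : ℕ) < b then 1 else 0 := by
  rw [cornerSum_succ]
  congr 1
  have h : ∀ j ∈ range b, entry (permMat σ) a j = if (σ a : ℕ) = j then 1 else 0 := by
    intro j hj
    have hjn : j < n := (mem_range.mp hj).trans_le hb
    simp [entry, permMat, hjn, Fin.ext_iff]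
  rw [sum_congr rfl h]
  simp

lemma cornerSum_permMat_revPerm (σ : Equiv.Perm (Fin n)) {a b : ℕ} (ha : a ≤ n) (hb : b ≤ n) :
    cornerSum (permMat (σ.trans Fin.revPerm)) a b = a - cornerSum (permMat σ) a (n - b) := by
  induction a with
  | zero => simp [cornerSum]
  | succ a ih =>
    have h₁ := cornerSum_permMat_succ σ ⟨a, ha⟩ (Nat.sub_le n b)
    have h₂ := cornerSum_permMat_succ (σ.trans Fin.revPerm) ⟨a, ha⟩ hb
    have h₃ := ih (by omega)
    have := (σ ⟨a, ha⟩).isLt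
    simp only [Equiv.trans_apply, Fin.revPerm_apply, Fin.val_rev] at h₁ h₂
    split_ifs at h₁ h₂ <;> push_cast <;> omega

/-- The bigrassmannian permutation whose corner sums are the largest ones compatible with
the value `r` at `(k, l)`. -/
lemma exists_perm_cornerSum {k l r : ℕ} (hrk : r ≤ k) (hrl : r ≤ l) (hr : k + l ≤ n + r) :
    ∃ σ : Equiv.Perm (Fin n), ∀ a b, a ≤ n → b ≤ n →
      cornerSum (permMat σ) a b = (min (min a b) (r + (a - k) + (b - l)) : ℕ) := by
  let s : ℕ → ℕ := fun i =>
    if i < r then i else if i < k then i + (l - r) else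
      if i < k + l - r then i - (k - r) else i
  have hs : ∀ i < n, s i < n := by
    intro i hi
    simp only [s]
    split_ifs <;> omega
  have hinj : Function.Injective fun i : Fin n => (⟨s i, hs i i.isLt⟩ : Fin n) := by
    intro i j hij
    simp only [s, Fin.mk.injEq] at hij
    ext
    split_ifs at hij <;> omega
  refine ⟨Equiv.ofBijective _ (Finite.injective_iff_bijective.mp hinj), fun a b ha hb => ?_⟩
  induction a with
  | zero => simp [cornerSum]
  | succ a ih =>
    have h := cornerSum_permMat_succ
      (Equiv.ofBijective _ (Finite.injective_iff_bijective.mp hinj)) ⟨a, ha⟩ hb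
    simp only [Equiv.ofBijective_apply] at h
    rw [h, ih (by omega)]
    simp only [s]
    split_ifs <;> omega

end Perm

section Density

variable {n : ℕ} {A : Matrix (Fin n) (Fin n) ℤ}

lemma IsASM.exists_permMatrix_le (hA : IsASM A) {k l : ℕ} (hk : k ≤ n) (hl : l ≤ n) :
    ∃ P : Matrix (Fin n) (Fin n) ℤ, IsPermMatrix P ∧ asmLe P A ∧
      cornerSum P k l = cornerSum A k l := by
  have hkl := hA.cornerSum_bounds hk hl
  obtain ⟨r, hr⟩ := Int.eq_ofNat_of_zero_le hkl.1
  obtain ⟨σ, hσ⟩ := exists_perm_cornerSum (n := n) (k := k) (l := l) (r := r)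
    (by omega) (by omega) (by omega)
  refine ⟨permMat σ, isPermMatrix_permMat σ, ?_, ?_⟩
  · rw [asmLe_iff_cornerSum]
    intro a b _ _ ha hb
    have := hA.cornerSum_bounds ha hb
    have := hA.cornerSum_le_add a b k l
    rw [hσ a b ha hb]
    omega
  · rw [hσ k l hk hl]
    omega

lemma IsASM.exists_le_permMatrix (hA : IsASM A) {k l : ℕ} (hk : k ≤ n) (hl : l ≤ n) :
    ∃ P : Matrix (Fin n) (Fin n) ℤ, IsPermMatrix P ∧ asmLe A P ∧
      cornerSum P k l = cornerSum A k l := by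
  have hkl := hA.cornerSum_bounds hk hl
  obtain ⟨r, hr⟩ := Int.eq_ofNat_of_zero_le hkl.1
  obtain ⟨σ, hσ⟩ := exists_perm_cornerSum (n := n) (k := k) (l := n - l) (r := k - r)
    (by omega) (by omega) (by omega)
  refine ⟨permMat (σ.trans Fin.revPerm), isPermMatrix_permMat _, ?_, ?_⟩
  · rw [asmLe_iff_cornerSum]
    intro a b _ _ ha hb
    have := hA.cornerSum_bounds ha hb
    have := hA.cornerSum_le_add k l a b
    rw [cornerSum_permMat_revPerm σ ha hb, hσ a _ ha (Nat.sub_le n b)]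
    omega
  · rw [cornerSum_permMat_revPerm σ hk hl, hσ k _ hk (Nat.sub_le n l)]
    omega

end Density

end ASMPaper

open ASMPaper in
/-- The permutation matrices are join-dense and meet-dense in `ASM_n`: every alternating
sign matrix `A` is the least upper bound of the permutation matrices `P ≤ A`, and the
greatest lower bound of the permutation matrices `P ≥ A`. -/
theorem asm_perm_join_meet_dense (n : ℕ) (hn : 1 ≤ n)
    (A : Matrix (Fin n) (Fin n) ℤ) (hA : IsASM A) :
    ((∀ P : Matrix (Fin n) (Fin n) ℤ, IsPermMatrix P → asmLe P A → asmLe P A) ∧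
     (∀ B : Matrix (Fin n) (Fin n) ℤ, IsASM B →
       (∀ P : Matrix (Fin n) (Fin n) ℤ, IsPermMatrix P → asmLe P A → asmLe P B) →
       asmLe A B)) ∧
    ((∀ P : Matrix (Fin n) (Fin n) ℤ, IsPermMatrix P → asmLe A P → asmLe A P) ∧
     (∀ B : Matrix (Fin n) (Fin n) ℤ, IsASM B →
       (∀ P : Matrix (Fin n) (Fin n) ℤ, IsPermMatrix P → asmLe A P → asmLe B P) →
       asmLe B A)) := by
  refine ⟨⟨fun _ _ h => h, fun B _ hB => ?_⟩, fun _ _ h => h, fun B _ hB => ?_⟩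
  · rw [asmLe_iff_cornerSum]
    intro a b ha hb han hbn
    obtain ⟨P, hP, hPA, heq⟩ := hA.exists_permMatrix_le han hbn
    rw [← heq]
    exact (asmLe_iff_cornerSum P B).mp (hB P hP hPA) a b ha hb han hbn
  · rw [asmLe_iff_cornerSum]
    intro a b ha hb han hbn
    obtain ⟨P, hP, hAP, heq⟩ := hA.exists_le_permMatrix han hbn
    rw [← heq]
    exact (asmLe_iff_cornerSum B P).mp (hB P hP hAP) a b ha hb han hbn
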